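/- Suppose c c' = 0 for all c,c' ∈ a (a is square-zero) and let (e,ι,π) be an extension of a by b. Then: (1) for any two k-linear maps σ, σ' : b → e with π ∘ σ = π ∘ σ' = id_b, one has σ(x) ι(c) = σ'(x) ι(c) and ι(c) σ(x) = ι(c) σ'(x) for all x ∈ b, c ∈ a; (2) the maps L, R : b → End_k(a) determined by ι(L x c) = σ(x) ι(c) and ι(R x c) = ι(c) σ(x) are therefore independent of the choice of section and constitute a b-bimodule structure on a, i.e., L (x y) = L x ∘ L y, R (x y) = R y ∘ R x and L x ∘ R y = R y ∘ L x for all x,y ∈ b. (Part of the necessity proof of Corollary 2.8/2.9: when a² = 0, a becomes a genuine b-bimodule.) -/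

import Mathlib

/-- If the kernel of `π` is the image of a square-zero algebra under `ι`, then elements of the
middle algebra with the same image under `π` act in the same way on the range of `ι`. -/
theorem mul_range_eq_of_map_eq {k A B E : Type*} [Monoid k]
    [NonUnitalRing A] [DistribMulAction k A] [NonUnitalRing B] [DistribMulAction k B]
    [NonUnitalRing E] [DistribMulAction k E]
    (hsq : ∀ c c' : A, c * c' = 0) (ι : A →ₙₐ[k] E) (π : E →ₙₐ[k] B)
    (hker : ∀ z : E, π z = 0 → z ∈ Set.range ι) {u v : E} (huv : π u = π v) (c : A) :
    u * ι c = v * ι c ∧ ι c * u = ι c * v := by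
  obtain ⟨d, hd⟩ := hker (u - v) (by rw [map_sub, huv, sub_self])
  constructor
  · rw [← sub_eq_zero, ← sub_mul, ← hd, ← map_mul, hsq, map_zero]
  · rw [← sub_eq_zero, ← mul_sub, ← hd, ← map_mul, hsq, map_zero]


/-- Part of the necessity proof of Corollary 2.8/2.9: if `a` is square-zero and
`(e, ι, π)` is an extension of `a` by `b`, then (1) the products `σ(x) ι(c)`
and `ι(c) σ(x)` do not depend on the choice of `k`-linear section `σ` of `π`,
and (2) the maps `L`, `R` determined by `ι (L x c) = σ x * ι c` and
`ι (R x c) = ι c * σ x` constitute a `b`-bimodule structure on `a`. -/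
theorem square_zero_extension_gives_bimodule
    {k : Type*} [Field k] {A B E : Type*}
    [NonUnitalRing A] [Module k A] [SMulCommClass k A A] [IsScalarTower k A A]
    [NonUnitalRing B] [Module k B] [SMulCommClass k B B] [IsScalarTower k B B]
    [NonUnitalRing E] [Module k E] [SMulCommClass k E E] [IsScalarTower k E E]
    (hsq : ∀ c c' : A, c * c' = 0)
    (ι : A →ₙₐ[k] E) (π : E →ₙₐ[k] B)
    (hinj : Function.Injective ι) (hsurj : Function.Surjective π)
    (hker : ∀ z : E, π z = 0 ↔ z ∈ Set.range ι)
    (σ : B →ₗ[k] E) (hσ : ∀ x : B, π (σ x) = x) :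
    (∀ σ' : B →ₗ[k] E, (∀ x : B, π (σ' x) = x) →
      ∀ (x : B) (c : A), σ x * ι c = σ' x * ι c ∧ ι c * σ x = ι c * σ' x) ∧
    (∀ L R : B → A → A,
      (∀ (x : B) (c : A), ι (L x c) = σ x * ι c) →
      (∀ (x : B) (c : A), ι (R x c) = ι c * σ x) →
      ((∀ (x y : B) (c : A), L (x * y) c = L x (L y c)) ∧
       (∀ (x y : B) (c : A), R (x * y) c = R y (R x c)) ∧
       (∀ (x y : B) (c : A), L x (R y c) = R y (L x c)))) := by
  have key {u v : E} (huv : π u = π v) (c : A) :=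
    mul_range_eq_of_map_eq hsq ι π (fun z => (hker z).1) huv c
  have hmul (x y : B) : π (σ (x * y)) = π (σ x * σ y) := by simp only [map_mul, hσ]
  refine ⟨fun σ' hσ' x c => key ((hσ x).trans (hσ' x).symm) c, fun L R hL hR => ⟨?_, ?_, ?_⟩⟩
  · intro x y c
    apply hinj
    rw [hL, hL, hL, (key (hmul x y) c).1, mul_assoc]
  · intro x y c
    apply hinj
    rw [hR, hR, hR, (key (hmul x y) c).2, mul_assoc]
  · intro x y c
    apply hinj
    rw [hL, hR, hR, hL, mul_assoc]
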